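/- Let (z,z',w,w') be admissible, N ≥ 1, and fix ν ∈ GT_N. Define g : GT_{N+1} → ℝ by g(λ) = Λ^{N+1}_N(λ,ν), and let 𝒟^{(N+1)} be the matrix on GT_{N+1} built from parameters (u,u',v,v') = (z+N, z'+N, w, w'). Then the function λ ↦ Σ_{κ∈GT_{N+1}} 𝒟^{(N+1)}(λ,κ) g(κ) (a sum with finitely many nonzero terms for each λ) tends to 0 along the cofinite filter on GT_{N+1}; i.e., for every ε > 0, |Σ_κ 𝒟^{(N+1)}(λ,κ) g(κ)| < ε for all but finitely many λ ∈ GT_{N+1}. In other words, 𝒟^{(N+1)} applied to Λ^{N+1}_N(·,ν) lies in C₀(GT_{N+1}). -/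

import Mathlib

/-- A signature of length `N`: a nonincreasing `N`-tuple of integers. -/
def Sig (N : ℕ) : Type := {f : Fin N → ℤ // ∀ i j : Fin N, i ≤ j → f j ≤ f i}

instance {N : ℕ} : DecidableEq (Sig N) := by unfold Sig; infer_instance

/-- Interlacing `ν ≺ λ` between a signature of length `N` and one of length `N+1`. -/
def Interlace {N : ℕ} (ν : Sig N) (lam : Sig (N + 1)) : Prop :=
  ∀ i : Fin N, lam.1 i.succ ≤ ν.1 i ∧ ν.1 i ≤ lam.1 i.castSucc

instance {N : ℕ} (ν : Sig N) (lam : Sig (N + 1)) : Decidable (Interlace ν lam) := by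
  unfold Interlace; infer_instance

/-- `∏_{i<j} (f i - i - f j + j)` (the Vandermonde-type product in shifted coordinates). -/
def vprod {N : ℕ} (f : Fin N → ℤ) : ℤ :=
  ∏ i : Fin N, ∏ j : Fin N,
    if i < j then (f i - (i : ℕ) - f j + (j : ℕ)) else 1

/-- The link (cotransition probability) `Λ^{N+1}_N(λ, ν)`. -/
noncomputable def link {N : ℕ} (lam : Sig (N + 1)) (ν : Sig N) : ℝ :=
  if Interlace ν lam then (Nat.factorial N : ℝ) * (vprod ν.1 : ℝ) / (vprod lam.1 : ℝ) else 0

/-- Shifted coordinates of a signature: `l_j = λ_j + N − j` (1-based), i.e.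
`lc λ i = λ_i + N − 1 − i` in 0-based indexing. -/
def lc {N : ℕ} (lam : Sig N) : Fin N → ℤ :=
  fun i => lam.1 i + (N : ℤ) - 1 - (i : ℕ)

/-- The Vandermonde product `∏_{i<j} (x_i − x_j)` (as a complex number). -/
def Vc {N : ℕ} (x : Fin N → ℤ) : ℂ :=
  ∏ i : Fin N, ∏ j : Fin N, if i < j then ((x i : ℂ) - (x j : ℂ)) else 1

/-- The one-dimensional bilateral birth-and-death rate matrix `𝒟` on `ℤ` with
parameters `(u,u',v,v')`. -/
def Dmat (u u' v v' : ℂ) (x y : ℤ) : ℂ :=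
  if y = x + 1 then ((x : ℂ) - u) * ((x : ℂ) - u')
  else if y = x - 1 then ((x : ℂ) + v) * ((x : ℂ) + v')
  else if y = x then -(((x : ℂ) - u) * ((x : ℂ) - u')) - ((x : ℂ) + v) * ((x : ℂ) + v')
  else 0

/-- The constant `d_N = N(N−1)(N−2)/3 − (u+u'+v+v')·N(N−1)/2`. -/
noncomputable def dConst (u u' v v' : ℂ) (N : ℕ) : ℂ :=
  (N : ℂ) * ((N : ℂ) - 1) * ((N : ℂ) - 2) / 3 -
    (u + u' + v + v') * ((N : ℂ) * ((N : ℂ) - 1)) / 2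

/-- The matrix `𝒟^{(N)}` of transition rates on `GT_N`:
`𝒟^{(N)}(λ,ν) = (V(n)/V(l)) Σ_i 𝒟(l_i,n_i)·[l_j = n_j ∀ j ≠ i] − d_N·[λ = ν]`. -/
noncomputable def DN (u u' v v' : ℂ) {N : ℕ} (lam ν : Sig N) : ℂ :=
  (Vc (lc ν) / Vc (lc lam)) *
      (∑ i : Fin N,
        if ∀ j : Fin N, j ≠ i → lc lam j = lc ν j then
          Dmat u u' v v' (lc lam i) (lc ν i) else 0) -
    (if lam = ν then dConst u u' v v' N else 0)

/-- Admissibility of the parameters `(z, z', w, w')`: `(z+k)(z'+k) > 0` and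
`(w+k)(w'+k) > 0` (as positive real numbers) for every `k ∈ ℤ`, and
`z + z' + w + w' > −1`. -/
def Admissible (z z' w w' : ℂ) : Prop :=
  (∀ k : ℤ, 0 < ((z + k) * (z' + k)).re ∧ ((z + k) * (z' + k)).im = 0) ∧
  (∀ k : ℤ, 0 < ((w + k) * (w' + k)).re ∧ ((w + k) * (w' + k)).im = 0) ∧
  ((-1 : ℝ) < (z + z' + w + w').re ∧ (z + z' + w + w').im = 0)

/-- The Askey–Lesky weight
`W(x) = 1/(Γ(z+N−x)Γ(z'+N−x)Γ(w+1+x)Γ(w'+1+x))`. -/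
noncomputable def Wfun (z z' w w' : ℂ) (N : ℕ) (x : ℤ) : ℂ :=
  1 / (Complex.Gamma (z + (N : ℂ) - (x : ℂ)) * Complex.Gamma (z' + (N : ℂ) - (x : ℂ)) *
        Complex.Gamma (w + 1 + (x : ℂ)) * Complex.Gamma (w' + 1 + (x : ℂ)))

/-- The unnormalized `N`-th level `zw`-weight
`M'_{z,z',w,w'|N}(λ) = V(l)² ∏_i W(l_i)`. -/
noncomputable def Mzw (z z' w w' : ℂ) {N : ℕ} (lam : Sig N) : ℂ :=
  (Vc (lc lam)) ^ 2 * ∏ i : Fin N, Wfun z z' w w' N (lc lam i)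

theorem Vc_lc {N : ℕ} (lam : Sig N) : Vc (lc lam) = (vprod lam.1 : ℂ) := by
  unfold Vc vprod lc
  push_cast
  refine Finset.prod_congr rfl fun i _ => Finset.prod_congr rfl fun j _ => ?_
  split_ifs
  · ring
  · simp

theorem vprod_factor_pos {N : ℕ} (lam : Sig N) (i j : Fin N) :
    0 < if i < j then (lam.1 i - (i : ℕ) - lam.1 j + (j : ℕ)) else (1 : ℤ) := by
  split_ifs with h
  · have h1 := lam.2 i j h.le
    have h2 : (i : ℕ) < j := h
    omega
  · exact one_pos

theorem vprod_pos {N : ℕ} (lam : Sig N) : 0 < vprod lam.1 :=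
  Finset.prod_pos fun i _ => Finset.prod_pos fun j _ => vprod_factor_pos lam i j

theorem vprod_cast_ne_zero {N : ℕ} (lam : Sig N) : (vprod lam.1 : ℂ) ≠ 0 :=
  Int.cast_ne_zero.mpr (vprod_pos lam).ne'

theorem lc_sub_le_vprod {N : ℕ} (lam : Sig N) {i j : Fin N} (hij : i < j) :
    lc lam i - lc lam j ≤ vprod lam.1 := by
  have hd : (if i < j then (lam.1 i - (i : ℕ) - lam.1 j + (j : ℕ)) else (1 : ℤ)) ∣
      vprod lam.1 :=
    (Finset.dvd_prod_of_mem (fun j : Fin N =>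
        if i < j then (lam.1 i - (i : ℕ) - lam.1 j + (j : ℕ)) else (1 : ℤ))
      (Finset.mem_univ j)).trans
    (Finset.dvd_prod_of_mem (fun i : Fin N => ∏ j : Fin N,
        if i < j then (lam.1 i - (i : ℕ) - lam.1 j + (j : ℕ)) else (1 : ℤ))
      (Finset.mem_univ i))
  have h := Int.le_of_dvd (vprod_pos lam) hd
  rw [if_pos hij] at h
  unfold lc
  linarith

theorem lc_injective {N : ℕ} : Function.Injective (lc : Sig N → Fin N → ℤ) := by
  intro a b h
  refine Subtype.ext (funext fun i => ?_)
  have := congrFun h i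
  unfold lc at this
  linarith

theorem lc_antitone {N : ℕ} (lam : Sig N) : Antitone (lc lam) := by
  intro i j h
  have h1 := lam.2 i j h
  have h2 : (i : ℕ) ≤ j := h
  unfold lc
  omega

/-- The endpoint separating slots `k` and `k + 1`. -/
def barrier {N : ℕ} (ν : Sig N) (k : Fin N) : ℤ := ν.1 k + N - (k : ℕ)

/-- The interval of values that the `i`-th shifted coordinate may take in a signature
interlacing with `ν`. -/
def slot {N : ℕ} (ν : Sig N) (i : Fin (N + 1)) : Set ℤ :=
  {y | (∀ k : Fin N, k.castSucc = i → barrier ν k ≤ y) ∧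
    ∀ k : Fin N, k.succ = i → y < barrier ν k}

theorem interlace_iff {N : ℕ} (ν : Sig N) (κ : Sig (N + 1)) :
    Interlace ν κ ↔ ∀ i, lc κ i ∈ slot ν i := by
  constructor
  · intro h i
    constructor
    · rintro k rfl
      have := (h k).2
      simp only [barrier, lc, Fin.val_castSucc]
      push_cast
      linarith
    · rintro k rfl
      have := (h k).1
      simp only [barrier, lc, Fin.val_succ]
      push_cast
      linarith
  · intro h k
    have h1 := (h k.castSucc).1 k rfl
    have h2 := (h k.succ).2 k rfl
    simp only [barrier, lc, Fin.val_castSucc, Fin.val_succ] at h1 h2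
    push_cast at h1 h2
    constructor <;> linarith

theorem exists_lc_eq {N : ℕ} (ν : Sig N) (n : Fin (N + 1) → ℤ) (h : ∀ i, n i ∈ slot ν i) :
    ∃ κ : Sig (N + 1), lc κ = n := by
  have ha : Antitone fun i : Fin (N + 1) => n i - N + (i : ℕ) := by
    rw [Fin.antitone_iff_succ_le]
    intro k
    have h1 := (h k.castSucc).1 k rfl
    have h2 := (h k.succ).2 k rfl
    simp only [Fin.val_castSucc, Fin.val_succ]
    push_cast
    linarith
  refine ⟨⟨fun i => n i - N + (i : ℕ), fun i j hij => ha hij⟩, ?_⟩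
  funext i
  simp only [lc]
  push_cast
  ring

open Classical in
/-- The one-dimensional rate matrix applied to the indicator function of a slot. -/
noncomputable def slotRate (u u' v v' : ℂ) {N : ℕ} (ν : Sig N) (i : Fin (N + 1)) (x : ℤ) : ℂ :=
  ∑ y ∈ Finset.Icc (x - 1) (x + 1), if y ∈ slot ν i then Dmat u u' v v' x y else 0

theorem Icc_sub_one_add_one (x : ℤ) : Finset.Icc (x - 1) (x + 1) = {x - 1, x, x + 1} := by
  ext y
  simp only [Finset.mem_Icc, Finset.mem_insert, Finset.mem_singleton]
  omega

theorem sum_Dmat (u u' v v' : ℂ) (x : ℤ) :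
    ∑ y ∈ Finset.Icc (x - 1) (x + 1), Dmat u u' v v' x y = 0 := by
  have h1 : x - 1 ≠ x + 1 := by omega
  have h2 : x ≠ x - 1 := by omega
  rw [Icc_sub_one_add_one, Finset.sum_insert (by simp [h1]), Finset.sum_insert (by simp),
    Finset.sum_singleton]
  simp only [Dmat, h1, h2, if_true, if_false, left_eq_add, one_ne_zero]
  ring

theorem mem_Icc_of_Dmat_ne_zero {u u' v v' : ℂ} {x y : ℤ} (h : Dmat u u' v v' x y ≠ 0) :
    y ∈ Finset.Icc (x - 1) (x + 1) := by
  unfold Dmat at h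
  rw [Finset.mem_Icc]
  split_ifs at h
  · omega
  · omega
  · omega
  · exact absurd rfl h

/-- The rates of a slot indicator vanish away from the barriers. -/
theorem slotRate_eq_zero (u u' v v' : ℂ) {N : ℕ} (ν : Sig N) (i : Fin (N + 1)) {x : ℤ}
    (hx : ∀ k, x ≠ barrier ν k ∧ x ≠ barrier ν k - 1) :
    slotRate u u' v v' ν i x = 0 := by
  classical
  have hmem : ∀ y ∈ Finset.Icc (x - 1) (x + 1), (y ∈ slot ν i ↔ x ∈ slot ν i) := by
    intro y hy
    rw [Finset.mem_Icc] at hy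
    have h1 : ∀ k, (barrier ν k ≤ y ↔ barrier ν k ≤ x) := fun k => by
      have := hx k
      omega
    have h2 : ∀ k, (y < barrier ν k ↔ x < barrier ν k) := fun k => by
      have := hx k
      omega
    simp only [slot, Set.mem_ofPred_eq, h1, h2]
  unfold slotRate
  by_cases h : x ∈ slot ν i
  · rw [← sum_Dmat u u' v v' x]
    exact Finset.sum_congr rfl fun y hy => if_pos ((hmem y hy).2 h)
  · exact Finset.sum_eq_zero fun y hy => if_neg fun hc => h ((hmem y hy).1 hc)

open Classical in
/-- The contribution of jumps of the `i`-th coordinate from `lam` to an interlacing `κ`. -/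
noncomputable def jumpTerm (u u' v v' : ℂ) {N : ℕ} (ν : Sig N) (lam : Sig (N + 1))
    (i : Fin (N + 1)) (κ : Sig (N + 1)) : ℂ :=
  if (∀ j, j ≠ i → lc lam j = lc κ j) ∧ Interlace ν κ then
    Dmat u u' v v' (lc lam i) (lc κ i) else 0

theorem lc_eq_of_agree {N : ℕ} {lam κ κ' : Sig N} {i : Fin N}
    (h : ∀ j, j ≠ i → lc lam j = lc κ j) (h' : ∀ j, j ≠ i → lc lam j = lc κ' j)
    (hi : lc κ i = lc κ' i) : κ = κ' := by
  refine lc_injective (funext fun j => ?_)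
  by_cases hj : j = i
  · rw [hj, hi]
  · rw [← h j hj, h' j hj]

theorem finite_support_jumpTerm (u u' v v' : ℂ) {N : ℕ} (ν : Sig N) (lam : Sig (N + 1))
    (i : Fin (N + 1)) : (Function.support (jumpTerm u u' v v' ν lam i)).Finite := by
  classical
  refine Set.Finite.of_finite_image (f := fun κ => lc κ i)
    ((Finset.Icc (lc lam i - 1) (lc lam i + 1)).finite_toSet.subset ?_) ?_
  · rintro _ ⟨κ, hκ, rfl⟩
    rw [Function.mem_support, jumpTerm] at hκ
    exact mem_Icc_of_Dmat_ne_zero (ite_ne_right_iff.1 hκ).2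
  · intro κ hκ κ' hκ' he
    rw [Function.mem_support, jumpTerm] at hκ hκ'
    exact lc_eq_of_agree (ite_ne_right_iff.1 hκ).1.1 (ite_ne_right_iff.1 hκ').1.1 he

open Classical in
theorem finsum_jumpTerm (u u' v v' : ℂ) {N : ℕ} (ν : Sig N) (lam : Sig (N + 1))
    (i : Fin (N + 1)) :
    ∑ᶠ κ, jumpTerm u u' v v' ν lam i κ =
      if ∀ j, j ≠ i → lc lam j ∈ slot ν j then slotRate u u' v v' ν i (lc lam i) else 0 := by
  split_ifs with h
  · set s : Set (Sig (N + 1)) := {κ | (∀ j, j ≠ i → lc lam j = lc κ j) ∧ Interlace ν κ ∧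
      lc κ i ∈ Finset.Icc (lc lam i - 1) (lc lam i + 1)}
    have hsupp : Function.support (jumpTerm u u' v v' ν lam i) ⊆ s := by
      intro κ hκ
      rw [Function.mem_support, jumpTerm] at hκ
      obtain ⟨h1, h2⟩ := ite_ne_right_iff.1 hκ
      exact ⟨h1.1, h1.2, mem_Icc_of_Dmat_ne_zero h2⟩
    have h1 : ∑ᶠ κ, jumpTerm u u' v v' ν lam i κ =
        ∑ᶠ κ ∈ s, jumpTerm u u' v v' ν lam i κ := by
      rw [finsum_mem_def, Set.indicator_eq_self.2 hsupp]
    rw [slotRate, ← Finset.sum_filter, h1, ← finsum_mem_coe_finset]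
    refine finsum_mem_eq_of_bijOn (fun κ => lc κ i) ⟨?_, ?_, ?_⟩ ?_
    · rintro κ ⟨-, h2, h3⟩
      exact Finset.mem_coe.2 (Finset.mem_filter.2 ⟨h3, (interlace_iff ν κ).1 h2 i⟩)
    · exact fun κ hκ κ' hκ' he => lc_eq_of_agree hκ.1 hκ'.1 he
    · intro y hy
      obtain ⟨hy1, hy2⟩ := Finset.mem_filter.1 (Finset.mem_coe.1 hy)
      have hslot : ∀ j, Function.update (lc lam) i y j ∈ slot ν j := by
        intro j
        by_cases hj : j = i
        · subst hj; simpa using hy2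
        · simpa [hj] using h j hj
      obtain ⟨κ, hκ⟩ := exists_lc_eq ν _ hslot
      have hi : lc κ i = y := by simp [hκ]
      refine ⟨κ, ⟨fun j hj => by simp [hκ, hj], (interlace_iff ν κ).2 fun j => ?_, ?_⟩, hi⟩
      · rw [hκ]; exact hslot j
      · rwa [hi]
    · rintro κ ⟨h2, h3, -⟩
      exact if_pos ⟨h2, h3⟩
  · refine finsum_eq_zero_of_forall_eq_zero fun κ => if_neg fun hc => h fun j hj => ?_
    rw [hc.1 j hj]
    exact (interlace_iff ν κ).1 hc.2 j

theorem DN_mul_link (u u' v v' : ℂ) {N : ℕ} (ν : Sig N) (lam κ : Sig (N + 1)) :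
    DN u u' v v' lam κ * ((link κ ν : ℝ) : ℂ) =
      (N.factorial * vprod ν.1 / vprod lam.1 : ℂ) *
          ∑ i, jumpTerm u u' v v' ν lam i κ -
        if κ = lam then dConst u u' v v' (N + 1) * ((link lam ν : ℝ) : ℂ) else 0 := by
  classical
  have hκ := vprod_cast_ne_zero κ
  have hl := vprod_cast_ne_zero lam
  unfold DN
  rw [sub_mul]
  congr 1
  · simp only [link, jumpTerm, Vc_lc]
    by_cases h : Interlace ν κ
    · simp only [h, if_true, and_true]
      push_cast
      have e : ∀ S : ℂ, (vprod κ.1 / vprod lam.1 : ℂ) * S *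
          (N.factorial * vprod ν.1 / vprod κ.1) =
          (N.factorial * vprod ν.1 / vprod lam.1 : ℂ) * S := by
        intro S
        field_simp
      rw [e]
    · simp [h]
  · by_cases h : lam = κ
    · subst h; simp
    · rw [if_neg h, if_neg (Ne.symm h), zero_mul]

open Classical in
theorem finsum_DN_mul_link (u u' v v' : ℂ) {N : ℕ} (ν : Sig N) (lam : Sig (N + 1)) :
    ∑ᶠ κ, DN u u' v v' lam κ * ((link κ ν : ℝ) : ℂ) =
      (N.factorial * vprod ν.1 / vprod lam.1 : ℂ) *
        ((∑ i, if ∀ j, j ≠ i → lc lam j ∈ slot ν j then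
            slotRate u u' v v' ν i (lc lam i) else 0) -
          if Interlace ν lam then dConst u u' v v' (N + 1) else 0) := by
  simp only [DN_mul_link]
  have hfin : (Function.support fun κ => ∑ i, jumpTerm u u' v v' ν lam i κ).Finite := by
    refine (Set.finite_iUnion fun i => finite_support_jumpTerm u u' v v' ν lam i).subset ?_
    intro κ hκ
    obtain ⟨i, -, hi⟩ := Finset.exists_ne_zero_of_sum_ne_zero hκ
    exact Set.mem_iUnion.2 ⟨i, hi⟩
  rw [finsum_sub_distrib, ← mul_finsum, finsum_sum_comm, mul_sub]
  · simp only [finsum_jumpTerm]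
    congr 1
    rw [finsum_eq_single _ lam fun κ hκ => if_neg hκ, if_pos rfl, link]
    split_ifs
    · push_cast; ring
    · simp
  · exact fun i _ => finite_support_jumpTerm u u' v v' ν lam i
  · exact hfin.subset (Function.support_mul_subset_right _ _)
  · exact (Set.finite_singleton lam).subset fun κ hκ => (ite_ne_right_iff.1 hκ).1

/-- Lemma 4.6 of Borodin–Olshanski (key step): for admissible `(z,z',w,w')` and fixed
`ν ∈ GT_N`, the function `λ ↦ (𝒟^{(N+1)} g)(λ)` with `g = Λ^{N+1}_N(·,ν)` tends to `0`
along the cofinite filter on `GT_{N+1}`, i.e. it lies in `C₀(GT_{N+1})`; here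
`𝒟^{(N+1)}` is built from the parameters `(z+N, z'+N, w, w')`. -/
theorem stmt16 (z z' w w' : ℂ) (hadm : Admissible z z' w w')
    (N : ℕ) (hN : 1 ≤ N) (ν : Sig N) :
    Filter.Tendsto
      (fun lam : Sig (N + 1) =>
        ∑ᶠ κ : Sig (N + 1),
          DN (z + (N : ℂ)) (z' + (N : ℂ)) w w' lam κ * ((link κ ν : ℝ) : ℂ))
      Filter.cofinite (nhds 0) := by
  classical
  set u := z + (N : ℂ)
  set u' := z' + (N : ℂ)
  obtain ⟨m, rfl⟩ : ∃ m, N = m + 1 := ⟨N - 1, by omega⟩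
  set R : Sig (m + 1 + 1) → ℂ := fun lam =>
    (∑ i, if ∀ j, j ≠ i → lc lam j ∈ slot ν j then
      slotRate u u' w w' ν i (lc lam i) else 0) -
    if Interlace ν lam then dConst u u' w w' (m + 1 + 1) else 0 with hR
  obtain ⟨M, hM⟩ : ∃ M : ℤ, ∀ k, |barrier ν k| + 1 ≤ M :=
    ⟨∑ k, |barrier ν k| + 1, fun k => by
      have := Finset.single_le_sum (f := fun k => |barrier ν k|)
        (fun k _ => abs_nonneg _) (Finset.mem_univ k)
      linarith⟩
  have hfar : ∀ i x, slotRate u u' w w' ν i x ≠ 0 → |x| ≤ M := by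
    intro i x hx
    by_contra hc
    refine hx (slotRate_eq_zero _ _ _ _ _ _ fun k => ?_)
    have := hM k
    grind
  obtain ⟨B, hB⟩ : ∃ B : ℝ, ∀ i x, ‖slotRate u u' w w' ν i x‖ ≤ B := by
    refine ⟨∑ i, ∑ x ∈ Finset.Icc (-M) M, ‖slotRate u u' w w' ν i x‖, fun i x => ?_⟩
    by_cases h : slotRate u u' w w' ν i x = 0
    · rw [h, norm_zero]
      positivity
    · refine (Finset.single_le_sum (f := fun x => ‖slotRate u u' w w' ν i x‖)
        (fun _ _ => norm_nonneg _) (Finset.mem_Icc.2 (abs_le.1 (hfar i x h)))).trans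
        (Finset.single_le_sum
          (f := fun i => ∑ x ∈ Finset.Icc (-M) M, ‖slotRate u u' w w' ν i x‖)
          (fun _ _ => by positivity) (Finset.mem_univ i))
  have hB0 : 0 ≤ B := (norm_nonneg _).trans (hB 0 0)
  have hRle : ∀ lam, ‖R lam‖ ≤ (∑ _i : Fin (m + 1 + 1), B) + ‖dConst u u' w w' (m + 1 + 1)‖ := by
    intro lam
    refine (norm_sub_le _ _).trans (add_le_add (norm_sum_le_of_le _ fun i _ => ?_) ?_)
    · split_ifs
      · exact hB _ _
      · simpa using hB0
    · split_ifs
      · exact le_rfl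
      · simp
  have hmem0 : ∀ x ∈ slot ν 0, -M ≤ x := by
    intro x hx
    have h1 := hx.1 0 rfl
    have h2 := hM 0
    have h3 := neg_abs_le (barrier ν 0)
    linarith
  have hmemlast : ∀ x ∈ slot ν (Fin.last _), x ≤ M := by
    intro x hx
    have h1 := hx.2 (Fin.last m) rfl
    have h2 := hM (Fin.last m)
    have h3 := le_abs_self (barrier ν (Fin.last m))
    linarith
  have hRsupp : ∀ lam, R lam ≠ 0 → -M ≤ lc lam 0 ∧ lc lam (Fin.last _) ≤ M := by
    intro lam hne
    by_cases hI : Interlace ν lam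
    · have := (interlace_iff ν lam).1 hI
      exact ⟨hmem0 _ (this _), hmemlast _ (this _)⟩
    · simp only [hR, if_neg hI, sub_zero] at hne
      obtain ⟨i, -, hi⟩ := Finset.exists_ne_zero_of_sum_ne_zero hne
      obtain ⟨h1, h2⟩ := ite_ne_right_iff.1 hi
      have h3 := abs_le.1 (hfar _ _ h2)
      constructor
      · by_cases h : 0 = i
        · subst h; exact h3.1
        · exact hmem0 _ (h1 _ h)
      · by_cases h : Fin.last _ = i
        · subst h; exact h3.2
        · exact hmemlast _ (h1 _ h)
  set A : ℝ := ‖((m + 1).factorial * vprod ν.1 : ℂ)‖ *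
    ((∑ _i : Fin (m + 1 + 1), B) + ‖dConst u u' w w' (m + 1 + 1)‖) with hA
  rw [Metric.tendsto_nhds]
  intro ε hε
  rw [Filter.eventually_cofinite]
  obtain ⟨K, hK⟩ := exists_int_gt (A / ε)
  refine Set.Finite.of_finite_image (f := lc)
    ((Set.Finite.pi' fun _ : Fin (m + 1 + 1) =>
      Set.finite_Icc (-M - K) (M + K)).subset ?_) lc_injective.injOn
  rintro _ ⟨lam, hlam, rfl⟩
  rw [Set.mem_ofPred_eq, dist_zero_right, finsum_DN_mul_link, not_lt] at hlam
  change ε ≤ ‖_ * R lam‖ at hlam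
  have hR0 : R lam ≠ 0 := by
    intro h0
    rw [h0, mul_zero, norm_zero] at hlam
    linarith
  obtain ⟨hlo, hhi⟩ := hRsupp lam hR0
  have hV : (0 : ℝ) < vprod lam.1 := Int.cast_pos.2 (vprod_pos lam)
  have hVK : vprod lam.1 < K := by
    have h1 : ε ≤ A / vprod lam.1 := by
      refine hlam.trans ?_
      rw [norm_mul, norm_div, Complex.norm_intCast, abs_of_pos hV, div_mul_eq_mul_div, hA]
      gcongr
      exact hRle lam
    have h2 : (vprod lam.1 : ℝ) ≤ A / ε := by
      rw [le_div_iff₀ hV] at h1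
      rw [le_div_iff₀ hε]
      linarith
    exact_mod_cast h2.trans_lt hK
  have hd := lc_sub_le_vprod lam (i := 0) (j := Fin.last (m + 1)) (Fin.last_pos)
  intro i
  have h1 := lc_antitone lam (Fin.zero_le i)
  have h2 := lc_antitone lam (Fin.le_last i)
  constructor <;> linarith
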